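/- (Gelfand–Naimark theorem for quaternion B*-algebras) Let A be an ℍ-B*-algebra. Then there exist a real Hilbert space H and an isometric star-algebra homomorphism Φ from A into the bounded ℝ-linear operators on H (with adjoint as star), i.e. an ℝ-linear multiplicative map Φ : A → (H →L[ℝ] H) with Φ(a*) = (Φ(a))† and ‖Φ(a)‖ = ‖a‖ for all a ∈ A. In particular, A is a real C*-algebra. -/

import Mathlib

section DirectSum

variable {𝕜 ι : Type*} [RCLike 𝕜] {G : ι → Type*} [∀ i, NormedAddCommGroup (G i)]
  [∀ i, InnerProductSpace 𝕜 (G i)]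

/-- The diagonal operator on a Hilbert sum given by a uniformly bounded family of operators. -/
noncomputable def lp.diagonalCLM (T : ∀ i, G i →L[𝕜] G i) (C : ℝ) (hT : ∀ i, ‖T i‖ ≤ C) :
    lp G 2 →L[𝕜] lp G 2 :=
  have hle (x : lp G 2) (i : ι) : ‖T i (x i)‖ ≤ ‖((C : 𝕜) • x : lp G 2) i‖ := by
    rw [lp.coeFn_smul, Pi.smul_apply, norm_smul, RCLike.norm_ofReal]
    exact (T i).le_of_opNorm_le ((hT i).trans (le_abs_self C)) _
  LinearMap.mkContinuous
    { toFun x := ⟨fun i ↦ T i (x i),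
        memℓp_gen (((lp.memℓp ((C : 𝕜) • x)).summable (by simp)).of_nonneg_of_le
          (fun i ↦ by positivity) fun i ↦ by gcongr; exact hle x i)⟩
      map_add' x y := by ext i; simp; rfl
      map_smul' c x := by ext i; simp }
    |C| fun x ↦ by
      have := lp.norm_mono (p := 2) (by simp) (x := ⟨fun i ↦ T i (x i),
        memℓp_gen (((lp.memℓp ((C : 𝕜) • x)).summable (by simp)).of_nonneg_of_le
          (fun i ↦ by positivity) fun i ↦ by gcongr; exact hle x i)⟩) (y := (C : 𝕜) • x) (hle x)
      simpa [norm_smul] using this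

@[simp]
lemma lp.diagonalCLM_apply (T : ∀ i, G i →L[𝕜] G i) (C : ℝ) (hT : ∀ i, ‖T i‖ ≤ C)
    (x : lp G 2) (i : ι) : lp.diagonalCLM T C hT x i = T i (x i) := rfl

end DirectSum

section GelfandNaimark

open scoped ComplexOrder InnerProductSpace ComplexStarModule

variable {D : Type*} [NonUnitalCStarAlgebra D]

/-- The Hilbert sum of a family of representations of a C⋆-algebra. -/
noncomputable def NonUnitalStarAlgHom.hilbertSum {ι : Type*} {G : ι → Type*}
    [∀ i, NormedAddCommGroup (G i)] [∀ i, InnerProductSpace ℂ (G i)] [∀ i, CompleteSpace (G i)]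
    (π : ∀ i, D →⋆ₙₐ[ℂ] (G i →L[ℂ] G i)) : D →⋆ₙₐ[ℂ] (lp G 2 →L[ℂ] lp G 2) where
  toFun a := lp.diagonalCLM (fun i ↦ π i a) ‖a‖ fun i ↦ NonUnitalStarAlgHom.norm_apply_le (π i) a
  map_smul' c a := by ext x i; simp
  map_zero' := by ext x i; simp
  map_add' a b := by ext x i; simp
  map_mul' a b := by ext x i; simp
  map_star' a := by
    rw [ContinuousLinearMap.star_eq_adjoint, ContinuousLinearMap.eq_adjoint_iff]
    intro x y
    simp only [lp.inner_eq_tsum, lp.diagonalCLM_apply, map_star,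
      ContinuousLinearMap.star_eq_adjoint, ContinuousLinearMap.adjoint_inner_left]

lemma NonUnitalStarAlgHom.hilbertSum_apply {ι : Type*} {G : ι → Type*}
    [∀ i, NormedAddCommGroup (G i)] [∀ i, InnerProductSpace ℂ (G i)] [∀ i, CompleteSpace (G i)]
    (π : ∀ i, D →⋆ₙₐ[ℂ] (G i →L[ℂ] G i)) (a : D) (x : lp G 2) (i : ι) :
    hilbertSum π a x i = π i a (x i) := rfl

variable [PartialOrder D] [StarOrderedRing D]

lemma CStarAlgebra.exists_positiveLinearMap_ne_zero {h : D} (h0 : 0 ≤ h) (hne : h ≠ 0) :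
    ∃ f : D →ₚ[ℂ] ℂ, f h ≠ 0 := by
  have hmem : -h ∉ ProperCone.positive ℝ D := by
    intro hm
    rw [ProperCone.mem_positive] at hm
    exact hne (le_antisymm (neg_nonneg.mp hm) h0)
  obtain ⟨f, hf, hfh⟩ := ProperCone.hyperplane_separation_point _ hmem
  let g : D →ₗ[ℂ] ℂ :=
    { toFun a := f (ℜ a : D) + Complex.I * f (ℑ a : D)
      map_add' a b := by simp; ring
      map_smul' c a := by
        simp [realPart_smul, imaginaryPart_smul]
        apply Complex.ext <;> simp }
  refine ⟨PositiveLinearMap.mk₀ g fun x hx ↦ ?_, ?_⟩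
  · have hx' : (ℜ x : D) = x := (IsSelfAdjoint.of_nonneg hx).coe_realPart
    have hx'' : ℑ x = 0 := (IsSelfAdjoint.of_nonneg hx).imaginaryPart
    have := hf x hx
    simpa [g, hx', hx''] using this
  · have hx' : (ℜ h : D) = h := (IsSelfAdjoint.of_nonneg h0).coe_realPart
    have hx'' : ℑ h = 0 := (IsSelfAdjoint.of_nonneg h0).imaginaryPart
    have : f h ≠ 0 := by
      rw [map_neg] at hfh
      exact (neg_lt_zero.mp hfh).ne'
    change g h ≠ 0
    simpa [g, hx', hx''] using this

/-- The **Gelfand–Naimark theorem** for complex C⋆-algebras. -/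
theorem NonUnitalCStarAlgebra.exists_isometric_representation.{u} (D : Type u)
    [NonUnitalCStarAlgebra D] :
    ∃ (H : Type u) (_ : NormedAddCommGroup H) (_ : InnerProductSpace ℂ H) (_ : CompleteSpace H)
      (π : D →⋆ₙₐ[ℂ] (H →L[ℂ] H)), ∀ a, ‖π a‖ = ‖a‖ := by
  let _ := CStarAlgebra.spectralOrder D
  let _ := CStarAlgebra.spectralOrderedRing D
  classical
  refine ⟨lp (fun f : D →ₚ[ℂ] ℂ ↦ f.GNS) 2, inferInstance, inferInstance, inferInstance,
    NonUnitalStarAlgHom.hilbertSum fun f ↦ f.gnsNonUnitalStarAlgHom, ?_⟩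
  refine NonUnitalStarAlgHom.norm_map _ ?_
  refine (injective_iff_map_eq_zero _).mpr fun a ha ↦ ?_
  by_contra hne
  have hh : star (a * star a) * (a * star a) ≠ 0 := by
    rwa [Ne, CStarRing.star_mul_self_eq_zero_iff, CStarRing.mul_star_self_eq_zero_iff]
  obtain ⟨f, hf⟩ := CStarAlgebra.exists_positiveLinearMap_ne_zero (star_mul_self_nonneg _) hh
  apply hf
  have key := congrFun (congrArg Subtype.val
    (DFunLike.congr_fun ha (lp.single 2 f (f.toPreGNS (star a) : f.GNS)))) f
  rw [NonUnitalStarAlgHom.hilbertSum_apply] at key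
  have : ‖f.toPreGNS (a * star a)‖ = 0 := by
    rw [← UniformSpace.Completion.norm_coe, norm_eq_zero]
    simpa using key
  rw [← f.ofPreGNS_toPreGNS (a * star a), ← f.preGNS_norm_sq, this]
  simp

end GelfandNaimark

/-- Left and right multiplication by the quaternion units `i` and `j` on a real normed ⋆-algebra,
as a compatible collection of real-linear operators. -/
structure QuaternionStructure (A : Type*) [NonUnitalNormedRing A] [StarRing A]
    [NormedSpace ℝ A] where
  (Li Lj Ri Rj : A →ₗ[ℝ] A)
  Li_Li (x : A) : Li (Li x) = -x
  Lj_Lj (x : A) : Lj (Lj x) = -x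
  Lj_Li (x : A) : Lj (Li x) = -Li (Lj x)
  Ri_Ri (x : A) : Ri (Ri x) = -x
  Rj_Rj (x : A) : Rj (Rj x) = -x
  Rj_Ri (x : A) : Rj (Ri x) = -Ri (Rj x)
  Ri_Li (x : A) : Ri (Li x) = Li (Ri x)
  Ri_Lj (x : A) : Ri (Lj x) = Lj (Ri x)
  Rj_Li (x : A) : Rj (Li x) = Li (Rj x)
  Rj_Lj (x : A) : Rj (Lj x) = Lj (Rj x)
  Li_mul (x y : A) : Li x * y = Li (x * y)
  Lj_mul (x y : A) : Lj x * y = Lj (x * y)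
  Ri_mul (x y : A) : Ri x * y = x * Li y
  Rj_mul (x y : A) : Rj x * y = x * Lj y
  mul_Ri (x y : A) : x * Ri y = Ri (x * y)
  mul_Rj (x y : A) : x * Rj y = Rj (x * y)
  star_Li (x : A) : star (Li x) = -Ri (star x)
  star_Lj (x : A) : star (Lj x) = -Rj (star x)
  star_Ri (x : A) : star (Ri x) = -Li (star x)
  star_Rj (x : A) : star (Rj x) = -Lj (star x)
  norm_smul_add_smul_Li_le (r s : ℝ) (x : A) : ‖r • x + s • Li x‖ ≤ ‖(⟨r, s⟩ : ℂ)‖ * ‖x‖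
  norm_Lj_le (x : A) : ‖Lj x‖ ≤ ‖x‖
  norm_Ri_le (x : A) : ‖Ri x‖ ≤ ‖x‖
  norm_Rj_le (x : A) : ‖Rj x‖ ≤ ‖x‖

lemma le_of_le_const_mul_of_cstar {A : Type*} [Mul A] [Star A] {p q : A → ℝ}
    (hq : ∀ a, 0 ≤ q a)
    (hp' : ∀ a, p (star a * a) = p a ^ 2) (hq' : ∀ a, q (star a * a) = q a ^ 2)
    {K : ℝ} (h : ∀ a, p a ≤ K * q a) (a : A) : p a ≤ q a := by
  have key (n : ℕ) : ∃ b, p b = p a ^ 2 ^ n ∧ q b = q a ^ 2 ^ n := by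
    induction n with
    | zero => exact ⟨a, by simp, by simp⟩
    | succ n ih =>
      obtain ⟨b, hb, hb'⟩ := ih
      exact ⟨star b * b, by rw [hp', hb]; ring, by rw [hq', hb']; ring⟩
  by_contra! hlt
  rcases (hq a).eq_or_lt with h0 | h0
  · have := h a
    rw [← h0] at this hlt
    linarith
  obtain ⟨n, hn⟩ := pow_unbounded_of_one_lt K ((one_lt_div h0).mpr hlt)
  obtain ⟨b, hb, hb'⟩ := key n
  have h1 := h b
  rw [hb, hb', ← div_le_iff₀ (by positivity), ← div_pow] at h1
  have h2 := pow_le_pow_right₀ ((one_lt_div h0).mpr hlt).le (Nat.lt_two_pow_self (n := n)).le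
  linarith

namespace QuaternionStructure

variable {A : Type*} [NonUnitalNormedRing A] [StarRing A] [NormedSpace ℝ A]
  (Q : QuaternionStructure A)

lemma norm_Li_le (x : A) : ‖Q.Li x‖ ≤ ‖x‖ := by
  have : ‖(⟨0, 1⟩ : ℂ)‖ = 1 := Complex.norm_I
  simpa [this] using Q.norm_smul_add_smul_Li_le 0 1 x

/-- The commutant of the quaternion unit `i`. -/
def commutant : NonUnitalStarSubalgebra ℝ A where
  carrier := {x | Q.Li x = Q.Ri x}
  add_mem' {x y} hx hy := by simp_all
  zero_mem' := by simp
  mul_mem' {x y} hx hy := by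
    simp only [Set.mem_ofPred_eq] at hx hy ⊢
    rw [← Q.Li_mul, hx, Q.Ri_mul, hy, Q.mul_Ri]
  smul_mem' c x hx := by simp_all
  star_mem' {x} hx := by
    simp only [Set.mem_ofPred_eq] at hx ⊢
    rw [← neg_inj, ← Q.star_Ri, ← Q.star_Li, hx]

lemma mem_commutant {x : A} : x ∈ Q.commutant ↔ Q.Li x = Q.Ri x := Iff.rfl

lemma isClosed_commutant : IsClosed (Q.commutant : Set A) :=
  isClosed_eq (Q.Li.mkContinuous 1 (by simpa using Q.norm_Li_le)).continuous
    (Q.Ri.mkContinuous 1 (by simpa using Q.norm_Ri_le)).continuous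

instance : SMul ℂ Q.commutant where
  smul z x := ⟨z.re • (x : A) + z.im • Q.Li x, by
    have hx := Q.mem_commutant.mp x.2
    simp [mem_commutant, Q.Ri_Li, ← hx]⟩

lemma coe_smul (z : ℂ) (x : Q.commutant) : ((z • x : Q.commutant) : A) =
    z.re • (x : A) + z.im • Q.Li x := rfl

noncomputable instance : NormedSpace ℂ Q.commutant where
  one_smul x := by ext; simp [coe_smul]
  mul_smul z w x := by
    ext
    simp only [coe_smul, Complex.mul_re, Complex.mul_im, map_add, map_smul, Q.Li_Li]
    module
  smul_zero z := by ext; simp [coe_smul]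
  smul_add z x y := by ext; simp [coe_smul]; module
  add_smul z w x := by ext; simp [coe_smul]; module
  zero_smul x := by ext; simp [coe_smul]
  norm_smul_le z x := Q.norm_smul_add_smul_Li_le z.re z.im x

noncomputable instance [IsScalarTower ℝ A A] [SMulCommClass ℝ A A] [StarModule ℝ A]
    [CompleteSpace A] [CStarRing A] : NonUnitalCStarAlgebra Q.commutant where
  toCompleteSpace := Q.isClosed_commutant.completeSpace_coe
  norm_mul_self_le x := CStarRing.norm_star_mul_self (x := (x : A)).symm.le
  smul_assoc z x y := by
    ext
    simp [coe_smul, add_mul, Q.Li_mul, smul_mul_assoc]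
  smul_comm z x y := by
    ext
    have hx := Q.mem_commutant.mp x.2
    simp [coe_smul, mul_add, ← Q.Li_mul, ← Q.Ri_mul, hx, mul_smul_comm]
  star_smul z x := by
    ext
    have hx := Q.mem_commutant.mp (star x).2
    simp [coe_smul, Q.star_Li, hx] at hx ⊢

/-- The projection of `A` onto the commutant of `i`. -/
noncomputable def proj (x : A) : Q.commutant :=
  ⟨(2⁻¹ : ℝ) • (x - Q.Li (Q.Ri x)), by
    simp [mem_commutant, Q.Li_Li, Q.Ri_Ri, Q.Ri_Li, add_comm]⟩

lemma coe_proj (x : A) : (Q.proj x : A) = (2⁻¹ : ℝ) • (x - Q.Li (Q.Ri x)) := rfl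

lemma proj_add (x y : A) : Q.proj (x + y) = Q.proj x + Q.proj y := by
  ext; simp [coe_proj]; module

lemma proj_smul (r : ℝ) (x : A) : Q.proj (r • x) = (r : ℂ) • Q.proj x := by
  ext
  simp only [coe_proj, coe_smul, Complex.ofReal_re, Complex.ofReal_im, map_smul]
  module

lemma star_proj [StarModule ℝ A] (x : A) : star (Q.proj x) = Q.proj (star x) := by
  ext; simp [coe_proj, Q.star_Li, Q.star_Ri, Q.Ri_Li]

lemma norm_proj_le (x : A) : ‖Q.proj x‖ ≤ ‖x‖ := by
  have h1 := (norm_sub_le x (Q.Li (Q.Ri x)))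
  have h2 := (Q.norm_Li_le (Q.Ri x)).trans (Q.norm_Ri_le x)
  rw [AddSubgroupClass.coe_norm, coe_proj, norm_smul]
  norm_num
  linarith

lemma proj_mul [IsScalarTower ℝ A A] [SMulCommClass ℝ A A] (x y : A) :
    Q.proj (x * y) = Q.proj x * Q.proj y + Q.proj (Q.Rj x) * Q.proj (-Q.Lj y) := by
  ext
  simp only [coe_proj, NonUnitalStarSubalgebra.coe_add, NonUnitalStarSubalgebra.coe_mul,
    map_neg, mul_sub, sub_mul, smul_mul_assoc, mul_smul_comm, mul_neg, map_sub,
    map_smul, Q.Li_mul, Q.Ri_mul, Q.Rj_mul, Q.mul_Ri, Q.Li_Li, Q.Lj_Lj, Q.Lj_Li, ← Q.Ri_Li]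
  module

lemma eq_proj_add (x : A) : x = Q.proj x + Q.Lj (Q.proj (-Q.Lj x)) := by
  simp only [coe_proj, map_neg, map_sub, map_smul, Q.Ri_Lj, Q.Lj_Li, Q.Lj_Lj]
  module

/-- The representation of `A` by `2 × 2` matrices over the commutant of `i`, given by
left multiplication on `A = Q.commutant ⊕ j • Q.commutant`. -/
noncomputable def toCStarMatrix (x : A) : CStarMatrix (Fin 2) (Fin 2) Q.commutant :=
  CStarMatrix.ofMatrix !![Q.proj x, Q.proj (Q.Rj x);
    Q.proj (-Q.Lj x), Q.proj (Q.Rj (-Q.Lj x))]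

lemma toCStarMatrix_add (x y : A) :
    Q.toCStarMatrix (x + y) = Q.toCStarMatrix x + Q.toCStarMatrix y := by
  ext i j
  fin_cases i <;> fin_cases j <;> simp [toCStarMatrix, ← proj_add, add_comm]

lemma toCStarMatrix_smul (r : ℝ) (x : A) :
    Q.toCStarMatrix (r • x) = (r : ℂ) • Q.toCStarMatrix x := by
  ext i j : 2
  rw [CStarMatrix.smul_apply]
  fin_cases i <;> fin_cases j <;> simp [toCStarMatrix, -Complex.coe_smul, ← proj_smul]

lemma toCStarMatrix_mul [IsScalarTower ℝ A A] [SMulCommClass ℝ A A] (x y : A) :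
    Q.toCStarMatrix (x * y) = Q.toCStarMatrix x * Q.toCStarMatrix y := by
  ext i j : 2
  rw [CStarMatrix.mul_apply, Fin.sum_univ_two]
  fin_cases i <;> fin_cases j <;>
    simp [toCStarMatrix, proj_mul, ← Q.mul_Rj, ← Q.Lj_mul, ← neg_mul, Q.Rj_Lj]

lemma toCStarMatrix_star [StarModule ℝ A] (x : A) :
    Q.toCStarMatrix (star x) = star (Q.toCStarMatrix x) := by
  ext i j : 2
  rw [CStarMatrix.star_apply]
  fin_cases i <;> fin_cases j <;>
    simp [toCStarMatrix, star_proj, Q.star_Rj, Q.star_Lj, Q.Rj_Lj]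

section Norm

variable [IsScalarTower ℝ A A] [SMulCommClass ℝ A A] [StarModule ℝ A]
  [CompleteSpace A] [CStarRing A] [PartialOrder Q.commutant] [StarOrderedRing Q.commutant]

lemma norm_le_two_mul_norm_toCStarMatrix (x : A) : ‖x‖ ≤ 2 * ‖Q.toCStarMatrix x‖ := by
  have h00 : ‖(Q.proj x : A)‖ ≤ ‖Q.toCStarMatrix x‖ :=
    (Q.toCStarMatrix x).norm_entry_le_norm (i := 0) (j := 0)
  have h10 : ‖(Q.proj (-Q.Lj x) : A)‖ ≤ ‖Q.toCStarMatrix x‖ :=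
    (Q.toCStarMatrix x).norm_entry_le_norm (i := 1) (j := 0)
  calc ‖x‖ ≤ ‖(Q.proj x : A)‖ + ‖Q.Lj (Q.proj (-Q.Lj x))‖ := by
        conv_lhs => rw [Q.eq_proj_add x]
        exact norm_add_le _ _
    _ ≤ ‖Q.toCStarMatrix x‖ + ‖Q.toCStarMatrix x‖ :=
        add_le_add h00 ((Q.norm_Lj_le _).trans h10)
    _ = 2 * ‖Q.toCStarMatrix x‖ := by ring

lemma exists_norm_toCStarMatrix_le : ∃ K, ∀ x, ‖Q.toCStarMatrix x‖ ≤ K * ‖x‖ := by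
  let L : (Fin 2 → Fin 2 → Q.commutant) →L[ℂ] CStarMatrix (Fin 2) (Fin 2) Q.commutant :=
    { toFun f := CStarMatrix.ofMatrix f
      map_add' _ _ := rfl
      map_smul' _ _ := rfl
      cont := continuous_id }
  refine ⟨‖L‖, fun x ↦ L.le_opNorm_of_le ?_⟩
  have hL := Q.norm_Lj_le x
  rw [← norm_neg] at hL
  refine (pi_norm_le_iff_of_nonneg (norm_nonneg x)).mpr fun i ↦
    (pi_norm_le_iff_of_nonneg (norm_nonneg x)).mpr fun j ↦ ?_
  fin_cases i <;> fin_cases j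
  · exact Q.norm_proj_le x
  · exact (Q.norm_proj_le _).trans (Q.norm_Rj_le x)
  · exact (Q.norm_proj_le _).trans hL
  · exact (Q.norm_proj_le _).trans ((Q.norm_Rj_le _).trans hL)

lemma norm_toCStarMatrix (x : A) : ‖Q.toCStarMatrix x‖ = ‖x‖ := by
  have hA (a : A) : ‖star a * a‖ = ‖a‖ ^ 2 := by rw [CStarRing.norm_star_mul_self, sq]
  have hM (a : A) : ‖Q.toCStarMatrix (star a * a)‖ = ‖Q.toCStarMatrix a‖ ^ 2 := by
    rw [toCStarMatrix_mul, toCStarMatrix_star, CStarRing.norm_star_mul_self, sq]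
  obtain ⟨K, hK⟩ := Q.exists_norm_toCStarMatrix_le
  exact le_antisymm
    (le_of_le_const_mul_of_cstar (p := fun a ↦ ‖Q.toCStarMatrix a‖) (fun _ ↦ norm_nonneg _) hM hA
      hK x)
    (le_of_le_const_mul_of_cstar (q := fun a ↦ ‖Q.toCStarMatrix a‖) (fun _ ↦ norm_nonneg _) hA hM
      Q.norm_le_two_mul_norm_toCStarMatrix x)

end Norm

/-- A real B⋆-algebra with a quaternionic structure acts isometrically on a real Hilbert space. -/
theorem exists_isometric_representation.{u} {A : Type u} [NonUnitalNormedRing A] [StarRing A]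
    [NormedSpace ℝ A] [IsScalarTower ℝ A A] [SMulCommClass ℝ A A] [StarModule ℝ A]
    [CompleteSpace A] [CStarRing A] (Q : QuaternionStructure A) :
    ∃ (H : Type u) (_ : NormedAddCommGroup H) (_ : InnerProductSpace ℝ H)
      (_ : CompleteSpace H) (Φ : A →ₗ[ℝ] (H →L[ℝ] H)),
      (∀ a b : A, Φ (a * b) = (Φ a).comp (Φ b)) ∧
      (∀ a : A, Φ (star a) = ContinuousLinearMap.adjoint (Φ a)) ∧
      (∀ a : A, ‖Φ a‖ = ‖a‖) := by
  let _ := CStarAlgebra.spectralOrder Q.commutant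
  let _ := CStarAlgebra.spectralOrderedRing Q.commutant
  obtain ⟨H, _, _, _, π, hπ⟩ := NonUnitalCStarAlgebra.exists_isometric_representation
    (CStarMatrix (Fin 2) (Fin 2) Q.commutant)
  let _ : InnerProductSpace ℝ H := .complexToReal
  refine ⟨H, inferInstance, inferInstance, inferInstance,
    { toFun a := (π (Q.toCStarMatrix a)).restrictScalars ℝ
      map_add' a b := by ext; simp [toCStarMatrix_add]
      map_smul' r a := by ext; simp [toCStarMatrix_smul, -Complex.coe_smul]; simp },
    fun a b ↦ ?_, fun a ↦ ?_, fun a ↦ ?_⟩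
  · ext; simp [toCStarMatrix_mul]
  · rw [ContinuousLinearMap.eq_adjoint_iff]
    intro x y
    change (inner ℂ (π (Q.toCStarMatrix (star a)) x) y).re =
      (inner ℂ x (π (Q.toCStarMatrix a) y)).re
    rw [toCStarMatrix_star, map_star, ContinuousLinearMap.star_eq_adjoint,
      ContinuousLinearMap.adjoint_inner_left]
  · simp [hπ, norm_toCStarMatrix]

end QuaternionStructure

open MulOpposite

local notation "ℍ" => Quaternion ℝ

theorem stmt17.{u} (A : Type u) [NonUnitalNormedRing A] [StarRing A] [NormedSpace ℝ A]
    [IsScalarTower ℝ A A] [SMulCommClass ℝ A A] [StarModule ℝ A]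
    [CompleteSpace A] [CStarRing A]
    [Module ℍ A] [Module ℍᵐᵒᵖ A] [IsScalarTower ℝ ℍ A] [IsScalarTower ℝ ℍᵐᵒᵖ A]
    [SMulCommClass ℍ ℍᵐᵒᵖ A]
    (hnb : ∀ (α β : ℍ) (a : A), ‖α • op β • a‖ ≤ ‖α‖ * ‖a‖ * ‖β‖)
    (h1 : ∀ (γ : ℍ) (a b : A), (γ • a) * b = γ • (a * b))
    (h2 : ∀ (γ : ℍ) (a b : A), (op γ • a) * b = a * (γ • b))
    (h3 : ∀ (γ : ℍ) (a b : A), op γ • (a * b) = a * (op γ • b))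
    (h4 : ∀ (α : ℍ) (b : A), star (α • b) = op (star α) • (star b))
    (h5 : ∀ (α : ℍ) (b : A), star (op α • b) = (star α) • (star b)) :
    ∃ (H : Type u) (_ : NormedAddCommGroup H) (_ : InnerProductSpace ℝ H)
      (_ : CompleteSpace H) (Φ : A →ₗ[ℝ] (H →L[ℝ] H)),
      (∀ a b : A, Φ (a * b) = (Φ a).comp (Φ b)) ∧
      (∀ a : A, Φ (star a) = ContinuousLinearMap.adjoint (Φ a)) ∧
      (∀ a : A, ‖Φ a‖ = ‖a‖) := by
  have hsm (r : ℝ) (γ : ℍ) (x : A) : γ • r • x = r • γ • x := by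
    rw [← smul_one_smul ℍ r x, smul_smul, mul_smul_comm, mul_one, smul_assoc]
  have hsm' (r : ℝ) (γ : ℍᵐᵒᵖ) (x : A) : γ • r • x = r • γ • x := by
    rw [← smul_one_smul ℍᵐᵒᵖ r x, smul_smul, mul_smul_comm, mul_one, smul_assoc]
  have hL (γ : ℍ) (x : A) : ‖γ • x‖ ≤ ‖γ‖ * ‖x‖ := by simpa using hnb γ 1 x
  have hR (γ : ℍ) (x : A) : ‖op γ • x‖ ≤ ‖γ‖ * ‖x‖ := by simpa [mul_comm] using hnb 1 γ x
  let L (γ : ℍ) : A →ₗ[ℝ] A :=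
    { toFun x := γ • x, map_add' := smul_add γ, map_smul' r x := hsm r γ x }
  let R (γ : ℍ) : A →ₗ[ℝ] A :=
    { toFun x := op γ • x, map_add' := smul_add (op γ), map_smul' r x := hsm' r (op γ) x }
  let i : ℍ := ⟨0, 1, 0, 0⟩
  let j : ℍ := ⟨0, 0, 1, 0⟩
  have ire : i.re = 0 := rfl
  have iI : i.imI = 1 := rfl
  have iJ : i.imJ = 0 := rfl
  have iK : i.imK = 0 := rfl
  have jre : j.re = 0 := rfl
  have jI : j.imI = 0 := rfl
  have jJ : j.imJ = 1 := rfl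
  have jK : j.imK = 0 := rfl
  have hii : i * i = -1 := by
    open scoped Quaternion in apply Quaternion.ext <;> simp [ire, iI, iJ, iK]
  have hjj : j * j = -1 := by
    open scoped Quaternion in apply Quaternion.ext <;> simp [jre, jI, jJ, jK]
  have hji : j * i = -(i * j) := by
    open scoped Quaternion in apply Quaternion.ext <;> simp [ire, iI, iJ, iK, jre, jI, jJ, jK]
  have hi : star i = -i := by open scoped Quaternion in apply Quaternion.ext <;> simp [ire]
  have hj : star j = -j := by open scoped Quaternion in apply Quaternion.ext <;> simp [jre]
  have hsq (γ : ℍ) (h : γ * γ = -1) : ‖γ‖ ≤ 1 := by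
    have := norm_mul γ γ
    rw [h, norm_neg, norm_one] at this
    nlinarith [norm_nonneg γ]
  have hL1 (γ : ℍ) (h : γ * γ = -1) (x : A) : ‖γ • x‖ ≤ ‖x‖ :=
    (hL γ x).trans (mul_le_of_le_one_left (norm_nonneg x) (hsq γ h))
  have hR1 (γ : ℍ) (h : γ * γ = -1) (x : A) : ‖op γ • x‖ ≤ ‖x‖ :=
    (hR γ x).trans (mul_le_of_le_one_left (norm_nonneg x) (hsq γ h))
  exact QuaternionStructure.exists_isometric_representation
    { Li := L i
      Lj := L j
      Ri := R i
      Rj := R j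
      Li_Li x := by simp [L, smul_smul, hii]
      Lj_Lj x := by simp [L, smul_smul, hjj]
      Lj_Li x := by simp [L, smul_smul, hji]
      Ri_Ri x := by simp [R, smul_smul, ← op_mul, hii]
      Rj_Rj x := by simp [R, smul_smul, ← op_mul, hjj]
      Rj_Ri x := by simp [R, smul_smul, ← op_mul, hji]
      Ri_Li x := (smul_comm i (op i) x).symm
      Ri_Lj x := (smul_comm j (op i) x).symm
      Rj_Li x := (smul_comm i (op j) x).symm
      Rj_Lj x := (smul_comm j (op j) x).symm
      Li_mul := h1 i
      Lj_mul := h1 j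
      Ri_mul := h2 i
      Rj_mul := h2 j
      mul_Ri x y := (h3 i x y).symm
      mul_Rj x y := (h3 j x y).symm
      star_Li x := by simp [L, R, h4, hi]
      star_Lj x := by simp [L, R, h4, hj]
      star_Ri x := by simp [L, R, h5, hi]
      star_Rj x := by simp [L, R, h5, hj]
      norm_smul_add_smul_Li_le r s x := by
        let q : ℍ := Quaternion.coeComplex ⟨r, s⟩
        have h : r • x + s • i • x = q • x := by
          rw [← smul_one_smul ℍ r x, ← smul_assoc, ← add_smul]
          congr 1
          open scoped Quaternion in apply Quaternion.ext <;> simp [q, ire, iI, iJ, iK]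
        have hn : ‖q‖ = ‖(⟨r, s⟩ : ℂ)‖ := by
          rw [← sq_eq_sq₀ (norm_nonneg _) (norm_nonneg _), sq ‖q‖,
            ← Quaternion.normSq_eq_norm_mul_self,
            ← Complex.normSq_eq_norm_sq, Quaternion.normSq_def', Complex.normSq_apply]
          simp [q, sq]
        rw [← hn]
        exact (congrArg norm h).trans_le (hL q x)
      norm_Lj_le := hL1 j hjj
      norm_Ri_le := hR1 i hii
      norm_Rj_le := hR1 j hjj }
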